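/- For integers l, n with l > n ≥ 1 and complex numbers x, y, one has G_l^n(x+y, y) + (−1)^n G_l^n(y+x, x) − ((−1)^n x^{l−n} + y^{l−n}) ζ(l) = Σ_{j₁,j₂≥1, j₁+j₂=n} (−1)^{j₂−1} Σ_{k₁,k₂≥1, k₁+k₂=l−n} x^{k₁} y^{k₂} ζ(k₁+1,{1}^{j₁−1}) ζ(k₂+1,{1}^{j₂−1}) + ( x^{l−n} + (−1)^n y^{l−n} ) ζ(l−n+1,{1}^{n−1}), where empty sums (occurring when n = 1 or l − n = 1) are 0 and {1}^k denotes a k-tuple of 1's. -/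

import Mathlib

open scoped BigOperators

/-- The multiple zeta value `ζ(l₁, …, lₙ)`, as a sum over strictly decreasing
tuples of positive integers. -/
noncomputable def mzv {n : ℕ} (l : Fin n → ℕ) : ℝ :=
  ∑' m : {m : Fin n → ℕ // StrictAnti m ∧ ∀ i, 0 < m i},
    ∏ i, ((m.1 i : ℝ) ^ (l i))⁻¹

/-- The Riemann zeta value `ζ(k)`. -/
noncomputable def rz (k : ℕ) : ℝ := ∑' m : ℕ+, ((m : ℝ) ^ k)⁻¹

/-- The weighted sum with two parameters
`G_l^n(x,y) = Σ_{l₁≥2, l₂,…,lₙ≥1, l₁+⋯+lₙ=l} x^(l₁-1) y^(l-l₁-(n-1)) ζ(l₁,…,lₙ)`. -/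
noncomputable def G (l n : ℕ) (x y : ℂ) : ℂ :=
  match n with
  | 0 => 0
  | k + 1 =>
    ∑ c ∈ (Finset.Nat.antidiagonalTuple (k + 1) l).filter
        (fun c => 2 ≤ c 0 ∧ ∀ i, 1 ≤ c i),
      x ^ (c 0 - 1) * y ^ (l - c 0 - k) * (mzv c : ℂ)

section HeightOne

open PowerSeries Finset NNReal ENNReal

/-- The elementary symmetric functions of `u 0, …, u (m - 1)`. -/
def esym {R : Type*} [CommSemiring R] (u : ℕ → R) : ℕ → ℕ → R
  | 0, _ => 1
  | N + 1, m => ∑ a ∈ range m, u a * esym u N a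

theorem map_esym {R S : Type*} [CommSemiring R] [CommSemiring S] (φ : R →+* S) (u : ℕ → R)
    (N m : ℕ) : φ (esym u N m) = esym (fun i => φ (u i)) N m := by
  induction N generalizing m with
  | zero => simp [esym]
  | succ N ih => simp [esym, ih]

/-- The connector `∏ (i - y) ∏ (j - y) / ∏ (k - y)` over `i ≤ n`, `j ≤ a`, `k ≤ n + a`. -/
noncomputable def connector (y : ℝ) (n a : ℕ) : ℝ :=
  (∏ i ∈ range n, ((i : ℝ) + 1 - y)) * (∏ i ∈ range a, ((i : ℝ) + 1 - y)) /
    ∏ i ∈ range (n + a), ((i : ℝ) + 1 - y)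

section Connector

variable {y : ℝ}

theorem natCast_add_one_sub_pos (hy : y < 1) (i : ℕ) : 0 < (i : ℝ) + 1 - y := by
  have : (0 : ℝ) ≤ i := i.cast_nonneg
  linarith

theorem prod_natCast_add_one_sub_pos (hy : y < 1) (n : ℕ) :
    0 < ∏ i ∈ range n, ((i : ℝ) + 1 - y) :=
  prod_pos fun i _ => natCast_add_one_sub_pos hy i

theorem connector_pos (hy : y < 1) (n a : ℕ) : 0 < connector y n a :=
  div_pos (mul_pos (prod_natCast_add_one_sub_pos hy n) (prod_natCast_add_one_sub_pos hy a))
    (prod_natCast_add_one_sub_pos hy _)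

theorem connector_comm (n a : ℕ) : connector y n a = connector y a n := by
  rw [connector, connector, add_comm n a, mul_comm (∏ i ∈ range n, _)]

theorem connector_zero_right (hy : y < 1) (n : ℕ) : connector y n 0 = 1 := by
  have := (prod_natCast_add_one_sub_pos hy n).ne'
  simp [connector, this]

theorem connector_sub_succ (hy : y < 1) (n a : ℕ) :
    connector y n a - connector y n (a + 1) =
      n * (connector y n (a + 1) * ((a : ℝ) + 1 - y)⁻¹) := by
  have h1 := (prod_natCast_add_one_sub_pos hy (n + a)).ne'
  have h2 := (natCast_add_one_sub_pos hy a).ne'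
  have h3 := (natCast_add_one_sub_pos hy (n + a)).ne'
  rw [connector, connector, ← add_assoc, prod_range_succ _ (n + a), prod_range_succ _ a]
  field_simp
  push_cast
  ring

theorem connector_succ_right_le (hy : y < 1) (n a : ℕ) :
    connector y n (a + 1) ≤ connector y n a := by
  rw [← sub_nonneg, connector_sub_succ hy]
  exact mul_nonneg n.cast_nonneg
    (mul_pos (connector_pos hy _ _) (inv_pos.2 (natCast_add_one_sub_pos hy a))).le

theorem tendsto_connector (hy : y < 1) (n : ℕ) :
    Filter.Tendsto (connector y (n + 1)) Filter.atTop (nhds 0) := by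
  have h1 : ∀ a, connector y 1 a = (1 - y) / ((a : ℝ) + 1 - y) := by
    intro a
    have h1 := (prod_natCast_add_one_sub_pos hy a).ne'
    have h3 := (natCast_add_one_sub_pos hy a).ne'
    rw [connector, add_comm 1 a, prod_range_succ _ a]
    simp
    field_simp
  have h2 : Filter.Tendsto (connector y 1) Filter.atTop (nhds 0) := by
    rw [funext h1]
    refine Filter.Tendsto.const_div_atTop ?_ _
    simp only [add_sub_assoc]
    exact Filter.tendsto_atTop_add_const_right _ _ tendsto_natCast_atTop_atTop
  refine squeeze_zero (fun a => (connector_pos hy _ a).le) (fun a => ?_) h2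
  induction n with
  | zero => exact le_rfl
  | succ n ih =>
    rw [connector_comm]
    refine (connector_succ_right_le hy _ _).trans ?_
    rwa [connector_comm]

theorem hasSum_connector (hy : y < 1) {n : ℕ} (hn : n ≠ 0) (m : ℕ) :
    HasSum (fun j : ℕ => ((j + m : ℕ) + 1 - y)⁻¹ * connector y n (j + m + 1))
      (connector y n m * (n : ℝ)⁻¹) := by
  have hn' : (n : ℝ) ≠ 0 := Nat.cast_ne_zero.2 hn
  rw [hasSum_iff_tendsto_nat_of_nonneg fun j => (mul_pos
    (inv_pos.2 (natCast_add_one_sub_pos hy _)) (connector_pos hy _ _)).le]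
  have : ∀ j : ℕ, ((j + m : ℕ) + 1 - y)⁻¹ * connector y n (j + m + 1) =
      connector y n (j + m) * (n : ℝ)⁻¹ - connector y n (j + 1 + m) * (n : ℝ)⁻¹ := by
    intro j
    rw [← sub_mul, show j + 1 + m = j + m + 1 by ring, connector_sub_succ hy]
    field_simp
  simp only [this, sum_range_sub' fun j => connector y n (j + m) * (n : ℝ)⁻¹]
  obtain ⟨n, rfl⟩ := Nat.exists_eq_succ_of_ne_zero hn
  have := (((tendsto_connector hy n).comp (Filter.tendsto_add_atTop_nat m)).mul_const
    (((n + 1 : ℕ) : ℝ)⁻¹)).const_sub (connector y (n + 1) m * (((n + 1 : ℕ) : ℝ)⁻¹))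
  simpa using this

end Connector

theorem ENNReal.tsum_mul_sum_range (F g : ℕ → ℝ≥0∞) :
    ∑' m, F m * ∑ j ∈ range m, g j = ∑' j, g j * ∑' i, F (i + (j + 1)) := by
  have h : ∀ m, F m * ∑ j ∈ range m, g j = ∑' j, if j < m then F m * g j else 0 := by
    intro m
    rw [mul_sum, tsum_eq_sum (s := range m) (fun j hj => if_neg (by simpa using hj))]
    exact sum_congr rfl fun j hj => by simp [mem_range.1 hj]
  simp only [h]
  rw [ENNReal.tsum_comm]
  refine tsum_congr fun j => ?_
  rw [← Summable.sum_add_tsum_nat_add' (k := j + 1) ENNReal.summable, sum_eq_zero,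
    zero_add, ← ENNReal.tsum_mul_left]
  · exact tsum_congr fun i => by rw [if_pos (by omega), mul_comm]
  · intro i hi
    have := mem_range.1 hi
    rw [if_neg (by omega)]

theorem tsum_mul_connector {y : ℝ} (hy : y < 1) {n : ℕ} (hn : n ≠ 0) (m : ℕ) :
    ∑' j : ℕ, ENNReal.ofReal (((j + m : ℕ) + 1 - y)⁻¹) *
      ENNReal.ofReal (connector y n (j + m + 1)) =
      ENNReal.ofReal (connector y n m) * ENNReal.ofReal (n : ℝ)⁻¹ := by
  rw [← ENNReal.ofReal_mul (connector_pos hy _ _).le, ← (hasSum_connector hy hn m).tsum_eq,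
    ENNReal.ofReal_tsum_of_nonneg _ (hasSum_connector hy hn m).summable]
  · exact tsum_congr fun j => (ENNReal.ofReal_mul
      (inv_pos.2 (natCast_add_one_sub_pos hy _)).le).symm
  · exact fun j => (mul_pos (inv_pos.2 (natCast_add_one_sub_pos hy _)) (connector_pos hy _ _)).le

theorem tsum_esym_mul_connector {y : ℝ} (hy : y < 1) {n : ℕ} (hn : n ≠ 0) (N : ℕ) :
    ∑' m : ℕ, ENNReal.ofReal (((m : ℝ) + 1 - y)⁻¹) * ENNReal.ofReal (connector y n (m + 1)) *
      esym (fun i : ℕ => ENNReal.ofReal (((i : ℝ) + 1 - y)⁻¹)) N m =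
      ENNReal.ofReal (n : ℝ)⁻¹ ^ (N + 1) := by
  induction N with
  | zero =>
    have := tsum_mul_connector hy hn 0
    simpa [esym, connector_zero_right hy] using this
  | succ N ih =>
    simp only [esym]
    rw [ENNReal.tsum_mul_sum_range, pow_succ, ← ih, ← ENNReal.tsum_mul_right]
    refine tsum_congr fun j => ?_
    have := tsum_mul_connector hy hn (j + 1)
    simp only [add_assoc] at this ⊢
    rw [this]
    ring

theorem sum_formula_generating {y : ℝ} (hy : y < 1) (N : ℕ) :
    ∑' m : ℕ, ENNReal.ofReal ((m : ℝ) + 1)⁻¹ * ENNReal.ofReal (((m : ℝ) + 1 - y)⁻¹) *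
      esym (fun i : ℕ => ENNReal.ofReal (((i : ℝ) + 1 - y)⁻¹)) N m =
    ∑' m : ℕ, ENNReal.ofReal ((m : ℝ) + 1)⁻¹ ^ (N + 1) *
      ENNReal.ofReal (((m : ℝ) + 1 - y)⁻¹) := by
  have h1 : ∀ m : ℕ, ENNReal.ofReal ((m : ℝ) + 1)⁻¹ = ∑' n : ℕ,
      ENNReal.ofReal (((n : ℝ) + 1 - y)⁻¹) * ENNReal.ofReal (connector y (n + 1) (m + 1)) := by
    intro m
    have := tsum_mul_connector hy m.succ_ne_zero 0
    simp only [connector_zero_right hy, add_zero, ENNReal.ofReal_one, one_mul] at this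
    rw [← Nat.cast_succ, ← this]
    exact tsum_congr fun n => by rw [connector_comm]
  have h2 := fun m : ℕ => tsum_esym_mul_connector hy m.succ_ne_zero N
  simp only [Nat.succ_eq_add_one, Nat.cast_add_one] at h2
  conv_rhs => simp only [← h2, ← ENNReal.tsum_mul_right]
  symm
  rw [ENNReal.tsum_comm]
  refine tsum_congr fun m => ?_
  rw [h1, ← ENNReal.tsum_mul_right, ← ENNReal.tsum_mul_right]
  exact tsum_congr fun n => by ring

theorem tsum_pow_injective_aux {a b : ℕ → ℝ≥0∞} (hfin : ∑' k, b k * ENNReal.ofReal 2⁻¹ ^ k ≠ ∞)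
    (h : ∀ y : ℝ, 0 < y → y < 1 →
      ∑' k, a k * ENNReal.ofReal y ^ k = ∑' k, b k * ENNReal.ofReal y ^ k) :
    a 0 ≤ b 0 := by
  set S := ∑' k, b k * ENNReal.ofReal 2⁻¹ ^ k
  have key : ∀ t : ℝ, 0 < t → t < 1 → a 0 ≤ b 0 + ENNReal.ofReal t * S := by
    intro t ht ht1
    have h1 := h (t * 2⁻¹) (by positivity) (by linarith)
    calc a 0 = a 0 * ENNReal.ofReal (t * 2⁻¹) ^ 0 := by simp
      _ ≤ _ := ENNReal.le_tsum 0
      _ = _ := h1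
      _ = b 0 + ∑' k, b (k + 1) * ENNReal.ofReal (t * 2⁻¹) ^ (k + 1) := by
        rw [tsum_eq_zero_add' ENNReal.summable]; simp
      _ ≤ b 0 + ENNReal.ofReal t * ∑' k, b (k + 1) * ENNReal.ofReal 2⁻¹ ^ (k + 1) := by
        gcongr
        rw [← ENNReal.tsum_mul_left]
        refine ENNReal.tsum_le_tsum fun k => ?_
        have : ENNReal.ofReal t ^ (k + 1) ≤ ENNReal.ofReal t := by
          refine pow_le_of_le_one zero_le ?_ k.succ_ne_zero
          simpa using ht1.le
        rw [ENNReal.ofReal_mul ht.le, mul_pow]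
        calc _ = ENNReal.ofReal t ^ (k + 1) * (b (k + 1) * ENNReal.ofReal 2⁻¹ ^ (k + 1)) := by ring
          _ ≤ _ := by gcongr
      _ ≤ _ := by
        gcongr
        exact ENNReal.tsum_comp_le_tsum_of_injective (add_left_injective 1)
          (fun k => b k * ENNReal.ofReal 2⁻¹ ^ k)
  have lim : Filter.Tendsto (fun t : ℝ => b 0 + ENNReal.ofReal t * S)
      (nhdsWithin 0 (Set.Ioi 0)) (nhds (b 0)) := by
    have : Filter.Tendsto (fun t : ℝ => ENNReal.ofReal t) (nhdsWithin 0 (Set.Ioi 0)) (nhds 0) := by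
      have := (ENNReal.continuous_ofReal.tendsto 0).mono_left (nhdsWithin_le_nhds (s := Set.Ioi 0))
      simpa using this
    simpa using (ENNReal.Tendsto.mul_const this (Or.inr hfin)).const_add (b 0)
  refine ge_of_tendsto lim ?_
  filter_upwards [Ioo_mem_nhdsGT (zero_lt_one' ℝ)] with t ht using key t ht.1 ht.2

theorem tsum_pow_injective {a b : ℕ → ℝ≥0∞} (hfin : ∑' k, b k * ENNReal.ofReal 2⁻¹ ^ k ≠ ∞)
    (h : ∀ y : ℝ, 0 < y → y < 1 →
      ∑' k, a k * ENNReal.ofReal y ^ k = ∑' k, b k * ENNReal.ofReal y ^ k) (k : ℕ) :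
    a k = b k := by
  induction k generalizing a b with
  | zero =>
    refine le_antisymm (tsum_pow_injective_aux hfin h) (tsum_pow_injective_aux ?_ fun y h0 h1 =>
      (h y h0 h1).symm)
    rwa [h _ (by norm_num) (by norm_num)]
  | succ k ih =>
    have h0 : a 0 = b 0 := le_antisymm (tsum_pow_injective_aux hfin h)
      (tsum_pow_injective_aux (by rwa [h _ (by norm_num) (by norm_num)]) fun y h0 h1 =>
      (h y h0 h1).symm)
    have shift : ∀ (c : ℕ → ℝ≥0∞) (y : ℝ), ∑' k, c k * ENNReal.ofReal y ^ k =
        c 0 + ENNReal.ofReal y * ∑' k, c (k + 1) * ENNReal.ofReal y ^ k := by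
      intro c y
      rw [tsum_eq_zero_add' ENNReal.summable, ← ENNReal.tsum_mul_left]
      simp only [pow_zero, mul_one]
      congr 1
      exact tsum_congr fun k => by ring
    have hb0 : b 0 ≠ ∞ := by
      intro hb
      exact hfin (by rw [shift, hb, top_add])
    refine ih (a := fun k => a (k + 1)) (b := fun k => b (k + 1)) ?_ ?_
    · intro htop
      refine hfin ?_
      rw [shift, htop, ENNReal.mul_top (by simp), add_top]
    · intro y hy0 hy1
      have := h y hy0 hy1
      rw [shift, shift b, h0, ENNReal.add_right_inj hb0] at this
      exact (ENNReal.mul_right_inj (by simpa using hy0) ENNReal.ofReal_ne_top).1 this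

theorem sum_antidiagonalTuple_succ {M : Type*} [AddCommMonoid M] (N i : ℕ)
    (f : (Fin (N + 1) → ℕ) → M) :
    ∑ δ ∈ Finset.Nat.antidiagonalTuple (N + 1) i, f δ =
      ∑ p ∈ antidiagonal i, ∑ δ ∈ Finset.Nat.antidiagonalTuple N p.2, f (Fin.cons p.1 δ) := by
  rw [Finset.sum_sigma']
  refine Finset.sum_bij' (fun δ _ => ⟨(δ 0, ∑ i, Fin.tail δ i), Fin.tail δ⟩)
    (fun p _ => Fin.cons p.1.1 p.2) ?_ ?_ ?_ ?_ ?_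
  · simp [Finset.Nat.mem_antidiagonalTuple, Fin.sum_univ_succ, Fin.tail]
  · rintro ⟨⟨a, b⟩, δ⟩ h
    simp only [mem_sigma, HasAntidiagonal.mem_antidiagonal, Finset.Nat.mem_antidiagonalTuple] at h
    simp [Finset.Nat.mem_antidiagonalTuple, Fin.sum_univ_succ, h]
  · simp
  · rintro ⟨⟨a, b⟩, δ⟩ h
    simp only [mem_sigma, HasAntidiagonal.mem_antidiagonal, Finset.Nat.mem_antidiagonalTuple] at h
    obtain ⟨-, rfl⟩ := h
    rfl
  · simp

/-- Evaluation of a power series with nonnegative coefficients at a nonnegative real. -/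
noncomputable def evalENNReal (y : ℝ) : ℝ≥0⟦X⟧ →+* ℝ≥0∞ where
  toFun f := ∑' k, ((coeff k f : ℝ≥0) : ℝ≥0∞) * ENNReal.ofReal y ^ k
  map_one' := by
    rw [tsum_eq_single 0 fun k hk => by simp [coeff_one, hk]]
    simp
  map_zero' := by simp
  map_add' f g := by simp [add_mul, ENNReal.tsum_add]
  map_mul' f g := by
    simp only [← ENNReal.tsum_mul_right]
    simp only [← ENNReal.tsum_mul_left]
    rw [← ENNReal.tsum_prod, ← HasAntidiagonal.sigmaAntidiagonalEquivProd.tsum_eq,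
      ENNReal.tsum_sigma']
    refine tsum_congr fun n => ?_
    rw [tsum_fintype, coeff_mul, ENNReal.ofNNReal_finsetSum, sum_mul,
      ← sum_coe_sort (antidiagonal n)]
    refine sum_congr rfl fun p _ => ?_
    have := HasAntidiagonal.mem_antidiagonal.1 p.2
    simp only [HasAntidiagonal.sigmaAntidiagonalEquivProd_apply, ENNReal.coe_mul]
    rw [show ENNReal.ofReal y ^ n = ENNReal.ofReal y ^ p.1.1 * ENNReal.ofReal y ^ p.1.2 by
      rw [← pow_add, this]]
    ring

theorem evalENNReal_apply (y : ℝ) (f : ℝ≥0⟦X⟧) :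
    evalENNReal y f = ∑' k, ((coeff k f : ℝ≥0) : ℝ≥0∞) * ENNReal.ofReal y ^ k := rfl

/-- The reciprocal of `m + 1`. -/
noncomputable def invSucc (m : ℕ) : ℝ≥0 := ((m : ℝ≥0) + 1)⁻¹

/-- The geometric series expansion of `1 / (m + 1 - X)`. -/
noncomputable def geo (m : ℕ) : ℝ≥0⟦X⟧ := PowerSeries.mk fun k => invSucc m ^ (k + 1)

theorem coe_invSucc (m : ℕ) : (invSucc m : ℝ≥0∞) = ENNReal.ofReal ((m : ℝ) + 1)⁻¹ := by
  rw [ENNReal.ofReal, ENNReal.coe_inj, ← NNReal.coe_inj, Real.coe_toNNReal _ (by positivity)]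
  simp [invSucc]

theorem evalENNReal_geo {y : ℝ} (h0 : 0 ≤ y) (hy : y < 1) (m : ℕ) :
    evalENNReal y (geo m) = ENNReal.ofReal (((m : ℝ) + 1 - y)⁻¹) := by
  have hm : (0 : ℝ) < (m : ℝ) + 1 := by positivity
  have hlt : y * ((m : ℝ) + 1)⁻¹ < 1 := by
    rw [← div_eq_mul_inv, div_lt_one hm]
    have : (0 : ℝ) ≤ m := m.cast_nonneg
    linarith
  have hs := (hasSum_geometric_of_lt_one (by positivity) hlt).mul_left ((m : ℝ) + 1)⁻¹
  have he : ((m : ℝ) + 1)⁻¹ * (1 - y * ((m : ℝ) + 1)⁻¹)⁻¹ = ((m : ℝ) + 1 - y)⁻¹ := by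
    rw [← mul_inv, mul_sub, mul_one, mul_left_comm, mul_inv_cancel₀ hm.ne', mul_one]
  rw [he] at hs
  rw [evalENNReal_apply, ← hs.tsum_eq, ENNReal.ofReal_tsum_of_nonneg _ hs.summable]
  · refine tsum_congr fun k => ?_
    rw [geo, coeff_mk, ENNReal.coe_pow, coe_invSucc, ← ENNReal.ofReal_pow (by positivity),
      ← ENNReal.ofReal_pow h0, ← ENNReal.ofReal_mul (by positivity)]
    congr 1
    ring
  · intro k
    positivity

/-- The sum of all `ζ(j + 1, l₂, …, l_{k+1})` with `l₂ + ⋯ + l_{k+1} = k + i`, as an extended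
nonnegative real. -/
noncomputable def depthSum (k j i : ℕ) : ℝ≥0∞ :=
  ∑' m, ((invSucc m ^ (j + 1) * coeff i (esym geo k m) : ℝ≥0) : ℝ≥0∞)

theorem tsum_invSucc_pow_ne_top {s : ℕ} (hs : 2 ≤ s) : ∑' m, (invSucc m : ℝ≥0∞) ^ s ≠ ∞ := by
  have : Summable fun m : ℕ => invSucc m ^ s := by
    rw [← NNReal.summable_coe]
    have := (_root_.summable_nat_add_iff 1).2 (Real.summable_nat_pow_inv.2 (show 1 < s by omega))
    simpa [invSucc] using this
  simpa using ENNReal.tsum_coe_ne_top_iff_summable.2 this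

theorem sum_depthSum (k d : ℕ) :
    ∑ p ∈ antidiagonal d, depthSum k (p.1 + 1) p.2 = ∑' m, (invSucc m : ℝ≥0∞) ^ (d + k + 2) := by
  refine tsum_pow_injective ?_ ?_ d
    (a := fun d => ∑ p ∈ antidiagonal d, depthSum k (p.1 + 1) p.2)
    (b := fun d => ∑' m, (invSucc m : ℝ≥0∞) ^ (d + k + 2))
  · have hle : ∀ d, ∑' m, (invSucc m : ℝ≥0∞) ^ (d + k + 2) ≤ ∑' m, (invSucc m : ℝ≥0∞) ^ 2 := by
      refine fun d => ENNReal.tsum_le_tsum fun m => ?_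
      refine pow_le_pow_of_le_one zero_le ?_ (by omega)
      rw [ENNReal.coe_le_one_iff]
      exact inv_le_one_of_one_le₀ (by simp)
    refine ne_top_of_le_ne_top ?_ (ENNReal.tsum_le_tsum fun d => mul_le_mul_left (hle d) _)
    rw [ENNReal.tsum_mul_left]
    refine ENNReal.mul_ne_top (tsum_invSucc_pow_ne_top le_rfl) ?_
    rw [ENNReal.tsum_geometric]
    simp
  · intro y h0 h1
    have := sum_formula_generating h1 k
    simp only [← evalENNReal_geo h0.le h1, ← coe_invSucc] at this
    simp only [← map_esym (evalENNReal y) geo, mul_assoc, ← map_mul] at this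
    simp only [evalENNReal_apply, ← ENNReal.tsum_mul_left] at this
    rw [ENNReal.tsum_comm] at this
    refine Eq.trans ?_ (this.trans (ENNReal.tsum_comm.trans ?_))
    · refine tsum_congr fun d => ?_
      simp only [depthSum]
      rw [← Summable.tsum_finsetSum fun _ _ => ENNReal.summable, ← ENNReal.tsum_mul_right]
      refine tsum_congr fun m => ?_
      rw [← mul_assoc, coeff_mul, ← ENNReal.coe_mul, mul_sum, ← ENNReal.ofNNReal_finsetSum]
      congr 2
      refine sum_congr rfl fun p _ => ?_
      rw [geo, coeff_mk]
      ring
    · refine tsum_congr fun d => ?_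
      rw [← ENNReal.tsum_mul_right]
      refine tsum_congr fun m => ?_
      rw [geo, coeff_mk, ENNReal.coe_pow]
      ring

theorem depthSum_ne_top (k i : ℕ) {j : ℕ} (hj : 1 ≤ j) : depthSum k j i ≠ ∞ := by
  obtain ⟨j, rfl⟩ := Nat.exists_eq_add_of_le' hj
  have h := sum_depthSum k (j + i)
  refine ne_top_of_le_ne_top (tsum_invSucc_pow_ne_top (s := j + i + k + 2) (by omega)) ?_
  rw [← h]
  exact single_le_sum (f := fun p : ℕ × ℕ => depthSum k (p.1 + 1) p.2) (fun _ _ => zero_le)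
    (show (j, i) ∈ antidiagonal (j + i) by simp)

/-- The truncated sum over `m ≥ m₁ > ⋯ > m_N ≥ 1`. -/
noncomputable def mzTrunc : (N : ℕ) → (Fin N → ℕ) → ℕ → ℝ≥0
  | 0, _, _ => 1
  | N + 1, c, m => ∑ a ∈ range m, invSucc a ^ c 0 * mzTrunc N (Fin.tail c) a

theorem sum_mzTrunc (N i m : ℕ) :
    ∑ δ ∈ Finset.Nat.antidiagonalTuple N i, mzTrunc N (fun r => δ r + 1) m =
      coeff i (esym geo N m) := by
  induction N generalizing i m with
  | zero => cases i <;> simp [mzTrunc, esym, coeff_one]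
  | succ N ih =>
    rw [sum_antidiagonalTuple_succ]
    simp only [mzTrunc, esym, map_sum, coeff_mul, ← ih]
    rw [sum_congr rfl fun p _ => sum_comm, sum_comm]
    refine sum_congr rfl fun a _ => sum_congr rfl fun p _ => ?_
    rw [mul_sum]
    refine sum_congr rfl fun δ _ => ?_
    rw [geo, coeff_mk]
    rfl

section Tuples

/-- Strictly decreasing tuples of positive integers satisfying `p`. -/
abbrev DecTuple (N : ℕ) (p : ℕ → Prop) : Type :=
  {m : Fin N → ℕ // StrictAnti m ∧ ∀ i, 0 < m i ∧ p (m i)}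

/-- A nonempty decreasing tuple is its largest entry followed by a bounded decreasing tuple. -/
def decTupleSuccEquiv (N : ℕ) (p : ℕ → Prop) (hp : ∀ a b, a ≤ b → p b → p a) :
    DecTuple (N + 1) p ≃ Σ a : {a : ℕ // p (a + 1)}, DecTuple N (· ≤ a.1) where
  toFun m := ⟨⟨m.1 0 - 1, by
      have := m.2.2 0
      rw [Nat.sub_add_cancel this.1]
      exact this.2⟩,
    ⟨Fin.tail m.1, fun i j h => m.2.1 (Fin.succ_lt_succ_iff.2 h), fun i =>
      ⟨(m.2.2 i.succ).1, Nat.le_sub_one_of_lt (m.2.1 (Fin.succ_pos i))⟩⟩⟩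
  invFun q := ⟨Fin.cons (q.1.1 + 1) q.2.1, by
    constructor
    · intro i j h
      induction j using Fin.cases with
      | zero => exact absurd h (Fin.not_lt_zero i)
      | succ j =>
        induction i using Fin.cases with
        | zero => simpa using Nat.lt_succ_of_le (q.2.2.2 j).2
        | succ i => simpa using q.2.2.1 (Fin.succ_lt_succ_iff.1 h)
    · intro i
      induction i using Fin.cases with
      | zero => simpa using q.1.2
      | succ i =>
        simpa using ⟨(q.2.2.2 i).1, hp _ _ (Nat.le_succ_of_le (q.2.2.2 i).2) q.1.2⟩⟩
  left_inv m := by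
    apply Subtype.ext
    have := (m.2.2 0).1
    simp only [Nat.sub_add_cancel this]
    exact Fin.cons_self_tail _
  right_inv q := by
    obtain ⟨⟨a, ha⟩, m, hm⟩ := q
    rfl

theorem tsum_decTuple_succ (N : ℕ) (p : ℕ → Prop) (hp : ∀ a b, a ≤ b → p b → p a)
    (c : Fin (N + 1) → ℕ) :
    ∑' m : DecTuple (N + 1) p, ∏ i, ((invSucc (m.1 i - 1) ^ c i : ℝ≥0) : ℝ≥0∞) =
      ∑' a : {a : ℕ // p (a + 1)}, (invSucc a.1 ^ c 0 : ℝ≥0) *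
        ∑' m : DecTuple N (· ≤ a.1), ∏ i, ((invSucc (m.1 i - 1) ^ Fin.tail c i : ℝ≥0) : ℝ≥0∞) := by
  rw [← (decTupleSuccEquiv N p hp).symm.tsum_eq, ENNReal.tsum_sigma']
  refine tsum_congr fun a => ?_
  rw [← ENNReal.tsum_mul_left]
  refine tsum_congr fun m => ?_
  rw [Fin.prod_univ_succ]
  rfl

theorem tsum_decTuple_le (N : ℕ) (c : Fin N → ℕ) (M : ℕ) :
    ∑' m : DecTuple N (· ≤ M), ∏ i, ((invSucc (m.1 i - 1) ^ c i : ℝ≥0) : ℝ≥0∞) =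
      mzTrunc N c M := by
  induction N generalizing M with
  | zero =>
    rw [tsum_eq_single ⟨Fin.elim0, fun i => i.elim0, fun i => i.elim0⟩]
    · simp [mzTrunc]
    · intro m hm
      exact absurd (Subtype.ext (Subsingleton.elim _ _)) hm
  | succ N ih =>
    rw [tsum_decTuple_succ N (· ≤ M) (fun a b h h' => h.trans h')]
    simp only [ih, mzTrunc, ENNReal.ofNNReal_finsetSum, ENNReal.coe_mul]
    refine (tsum_subtype {a : ℕ | a + 1 ≤ M} fun a => ((invSucc a ^ c 0 : ℝ≥0) : ℝ≥0∞) *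
      (mzTrunc N (Fin.tail c) a : ℝ≥0∞)).trans ?_
    rw [tsum_eq_sum (s := range M)]
    · refine sum_congr rfl fun a ha => Set.indicator_of_mem (s := {a : ℕ | a + 1 ≤ M}) ?_ _
      exact mem_range.1 ha
    · intro a ha
      refine Set.indicator_of_notMem (s := {a : ℕ | a + 1 ≤ M}) ?_ _
      simpa using ha

theorem mzv_eq_toReal (N : ℕ) (c : Fin (N + 1) → ℕ) :
    mzv c = (∑' m, ((invSucc m ^ c 0 * mzTrunc N (Fin.tail c) m : ℝ≥0) : ℝ≥0∞)).toReal := by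
  have h := tsum_decTuple_succ N (fun _ => True) (fun _ _ _ h => h) c
  simp only [tsum_decTuple_le] at h
  replace h := h.trans (tsum_subtype {a : ℕ | True} fun a => ((invSucc a ^ c 0 : ℝ≥0) : ℝ≥0∞) *
      (mzTrunc N (Fin.tail c) a : ℝ≥0∞))
  simp only [Set.ofPred_true, Set.indicator_univ, ← ENNReal.coe_mul] at h
  rw [← h, mzv, ENNReal.tsum_toReal_eq fun m => by simp [ENNReal.prod_ne_top]]
  let e : {m : Fin (N + 1) → ℕ // StrictAnti m ∧ ∀ i, 0 < m i} ≃ DecTuple (N + 1) fun _ => True :=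
    Equiv.subtypeEquivRight fun m => by simp
  rw [← e.tsum_eq]
  refine tsum_congr fun m => ?_
  rw [ENNReal.toReal_prod]
  refine prod_congr rfl fun i _ => ?_
  have : (invSucc (m.1 i - 1) : ℝ) = ((m.1 i : ℝ))⁻¹ := by
    obtain ⟨t, ht⟩ : ∃ t, m.1 i = t + 1 := ⟨m.1 i - 1, (Nat.sub_add_cancel (m.2.2 i)).symm⟩
    rw [ht]
    simp [invSucc]
  simp [e, this]

end Tuples

theorem rz_eq_toReal {s : ℕ} : rz s = (∑' m, (invSucc m : ℝ≥0∞) ^ s).toReal := by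
  rw [ENNReal.tsum_toReal_eq fun m => by simp, rz,
    tsum_pnat_eq_tsum_succ (f := fun m : ℕ => ((m : ℝ) ^ s)⁻¹)]
  exact tsum_congr fun m => by rw [ENNReal.toReal_pow, ENNReal.coe_toReal]; simp [invSucc]

theorem mzv_cons_ones (N j : ℕ) :
    mzv (Fin.cons (j + 1) (fun _ : Fin N => 1)) = (depthSum N j 0).toReal := by
  rw [mzv_eq_toReal, depthSum]
  congr 1
  refine tsum_congr fun m => ?_
  have h := sum_mzTrunc N 0 m
  rw [Finset.Nat.antidiagonalTuple_zero_right, sum_singleton] at h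
  rw [← h]
  rfl

theorem sum_mzv_antidiagonalTuple (N i : ℕ) {j : ℕ} (hj : 1 ≤ j) :
    ∑ δ ∈ Finset.Nat.antidiagonalTuple N i, mzv (Fin.cons (j + 1) fun r => δ r + 1) =
      (depthSum N j i).toReal := by
  have h : depthSum N j i = ∑ δ ∈ Finset.Nat.antidiagonalTuple N i,
      ∑' m, ((invSucc m ^ (j + 1) * mzTrunc N (fun r => δ r + 1) m : ℝ≥0) : ℝ≥0∞) := by
    rw [depthSum, ← Summable.tsum_finsetSum fun _ _ => ENNReal.summable]
    refine tsum_congr fun m => ?_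
    rw [← sum_mzTrunc, mul_sum, ENNReal.ofNNReal_finsetSum]
  have hfin := depthSum_ne_top N i hj
  rw [h] at hfin ⊢
  rw [ENNReal.toReal_sum fun δ hδ => ne_top_of_le_ne_top hfin
    (single_le_sum (f := fun δ : Fin N → ℕ => ∑' m, ((invSucc m ^ (j + 1) *
      mzTrunc N (fun r => δ r + 1) m : ℝ≥0) : ℝ≥0∞)) (fun _ _ => zero_le) hδ)]
  refine sum_congr rfl fun δ _ => ?_
  rw [mzv_eq_toReal]
  rfl

theorem G_eq_sum_depthSum (k d : ℕ) (x y : ℂ) :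
    G (k + 1 + (d + 1)) (k + 1) x y = ∑ p ∈ antidiagonal d,
      x ^ (p.1 + 1) * y ^ p.2 * ((depthSum k (p.1 + 1) p.2).toReal : ℂ) := by
  have h : ∀ p ∈ antidiagonal d,
      x ^ (p.1 + 1) * y ^ p.2 * ((depthSum k (p.1 + 1) p.2).toReal : ℂ) =
      ∑ δ ∈ Finset.Nat.antidiagonalTuple k p.2, x ^ (p.1 + 1) * y ^ p.2 *
        (mzv (Fin.cons (p.1 + 1 + 1) fun r => δ r + 1) : ℂ) := by
    intro p _
    rw [← sum_mzv_antidiagonalTuple k p.2 (Nat.le_add_left 1 p.1), ← mul_sum]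
    push_cast
    rfl
  have hsum : ∀ c : Fin (k + 1) → ℕ, (∀ i, 1 ≤ c i) →
      ∑ r : Fin k, (c r.succ - 1) + k = ∑ r : Fin k, c r.succ := by
    intro c hc
    calc ∑ r : Fin k, (c r.succ - 1) + k = ∑ r : Fin k, (c r.succ - 1 + 1) := by
          simp [sum_add_distrib]
      _ = _ := sum_congr rfl fun r _ => Nat.sub_add_cancel (hc r.succ)
  rw [G, sum_congr rfl h, Finset.sum_sigma']
  refine Finset.sum_bij' (fun c _ => ⟨(c 0 - 2, ∑ r, (c (Fin.succ r) - 1)), fun r => c r.succ - 1⟩)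
    (fun q _ => Fin.cons (q.1.1 + 2) fun r => q.2 r + 1) ?_ ?_ ?_ ?_ ?_
  · intro c hc
    simp only [mem_filter, Finset.Nat.mem_antidiagonalTuple, Fin.sum_univ_succ] at hc
    have := hsum c hc.2.2
    simp only [mem_sigma, HasAntidiagonal.mem_antidiagonal, Finset.Nat.mem_antidiagonalTuple,
      and_true]
    omega
  · rintro ⟨⟨a, b⟩, δ⟩ h
    simp only [mem_sigma, HasAntidiagonal.mem_antidiagonal,
      Finset.Nat.mem_antidiagonalTuple] at h
    simp only [mem_filter, Finset.Nat.mem_antidiagonalTuple, Fin.sum_univ_succ, Fin.cons_zero,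
      Fin.cons_succ, sum_add_distrib, h.2, Fin.forall_fin_succ]
    simp
    omega
  · intro c hc
    simp only [mem_filter] at hc
    funext r
    induction r using Fin.cases with
    | zero => simpa using Nat.sub_add_cancel hc.2.1
    | succ r => simpa using Nat.sub_add_cancel (hc.2.2 r.succ)
  · rintro ⟨⟨a, b⟩, δ⟩ h
    simp only [mem_sigma, HasAntidiagonal.mem_antidiagonal,
      Finset.Nat.mem_antidiagonalTuple] at h
    obtain ⟨-, rfl⟩ := h
    simp
  · intro c hc
    simp only [mem_filter, Finset.Nat.mem_antidiagonalTuple, Fin.sum_univ_succ] at hc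
    have := hsum c hc.2.2
    have h0 := hc.2.1
    have hc' : (Fin.cons (c 0 - 2 + 1 + 1) fun r : Fin k => c r.succ - 1 + 1 :
        Fin (k + 1) → ℕ) = c := by
      funext r
      induction r using Fin.cases with
      | zero => simp only [Fin.cons_zero]; omega
      | succ r => simpa using Nat.sub_add_cancel (hc.2.2 r.succ)
    simp only [hc']
    congr 3 <;> omega

theorem coeff_prod_one_add {R : Type*} [CommSemiring R] (u : ℕ → R) (N m : ℕ) :
    coeff N (∏ i ∈ range m, (1 + X * C (u i))) = esym u N m := by
  induction m generalizing N with
  | zero => cases N <;> simp [esym, coeff_one]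
  | succ m ih =>
    rw [prod_range_succ, mul_add, mul_one, map_add, ih, mul_left_comm]
    cases N with
    | zero => simp [esym]
    | succ N => rw [coeff_succ_X_mul, coeff_mul_C, ih]; simp [esym, sum_range_succ, mul_comm]

theorem coeff_prod_one_sub {R : Type*} [CommRing R] (u : ℕ → R) (N m : ℕ) :
    coeff N (∏ i ∈ range m, (1 + -X * C (u i))) = (-1) ^ N * esym u N m := by
  induction m generalizing N with
  | zero => cases N <;> simp [esym, coeff_one]
  | succ m ih =>
    rw [prod_range_succ, mul_add, mul_one, map_add, ih, mul_left_comm]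
    cases N with
    | zero => simp [esym]
    | succ N =>
      rw [neg_mul, map_neg, coeff_succ_X_mul, coeff_mul_C, ih]
      simp [esym, sum_range_succ]; ring

theorem prod_one_add_partial_fraction {A : Type*} [CommRing A] (v u : ℕ → A)
    (hv : ∀ i j, v i * v j = v (i + j + 1) * (v i + v j))
    (hu : ∀ i j, v i * u j = u (i + j + 1) * (v i + u j)) (z : A) (m : ℕ) :
    ∏ i ∈ range m, (1 + z * u i) = 1 + z * ∑ q ∈ range m,
      (∏ i ∈ range q, (1 + -z * v i)) * (∏ i ∈ range (m - 1 - q), (1 + z * v i)) * u q := by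
  have step : ∀ (w : ℕ → A) (z : A) (m : ℕ), (∀ i j, v i * w j = w (i + j + 1) * (v i + w j)) →
      ∏ i ∈ range m, (1 + z * w i) = 1 + z * (∑ q ∈ range m,
        (∏ i ∈ range q, (1 + -z * v i)) * (∏ i ∈ range (m - 1 - q), (1 + z * v i)) * w q) →
      ∏ i ∈ range m, (1 + -z * v i) = 1 + -z * (∑ q ∈ range m,
        (∏ i ∈ range q, (1 + z * v i)) * (∏ i ∈ range (m - 1 - q), (1 + -z * v i)) * v q) →
      ∏ i ∈ range (m + 1), (1 + z * w i) = 1 + z * (∑ q ∈ range (m + 1),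
        (∏ i ∈ range q, (1 + -z * v i)) * (∏ i ∈ range (m + 1 - 1 - q), (1 + z * v i)) * w q) := by
    intro w z m hw h1 h2
    rw [← sum_range_reflect] at h2
    have key : ∑ q ∈ range m,
        (∏ i ∈ range q, (1 + -z * v i)) * (∏ i ∈ range (m - q), (1 + z * v i)) * w q
        = ∑ q ∈ range m,
        (∏ i ∈ range q, (1 + -z * v i)) * (∏ i ∈ range (m - 1 - q), (1 + z * v i)) * w q
        + z * w m * (∑ q ∈ range m,
        (∏ i ∈ range q, (1 + -z * v i)) * (∏ i ∈ range (m - 1 - q), (1 + z * v i)) * w q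
        + ∑ q ∈ range m, (∏ i ∈ range (m - 1 - q), (1 + z * v i)) *
          (∏ i ∈ range (m - 1 - (m - 1 - q)), (1 + -z * v i)) * v (m - 1 - q)) := by
      rw [← sum_add_distrib, mul_sum, ← sum_add_distrib]
      refine sum_congr rfl fun q hq => ?_
      have hq := mem_range.1 hq
      rw [show m - q = m - 1 - q + 1 by omega, prod_range_succ,
        show m - 1 - (m - 1 - q) = q by omega]
      have := hw (m - 1 - q) q
      rw [show m - 1 - q + q + 1 = m by omega] at this
      linear_combination (∏ i ∈ range q, (1 + -z * v i)) *
        (∏ i ∈ range (m - 1 - q), (1 + z * v i)) * z * this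
    rw [sum_range_succ, prod_range_succ]
    simp only [Nat.add_sub_cancel, Nat.sub_self, range_zero, prod_empty, mul_one]
    rw [key]
    linear_combination (1 + z * w m) * h1 - z * w m * h2
  have hvv : ∀ (m : ℕ) (z : A), ∏ i ∈ range m, (1 + z * v i) = 1 + z * ∑ q ∈ range m,
      (∏ i ∈ range q, (1 + -z * v i)) * (∏ i ∈ range (m - 1 - q), (1 + z * v i)) * v q := by
    intro m
    induction m with
    | zero => simp
    | succ m ih =>
      intro z
      refine step v z m hv (ih z) ?_
      simpa only [neg_neg] using ih (-z)
  induction m with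
  | zero => simp
  | succ m ih =>
    refine step u z m hu ih ?_
    simpa only [neg_neg] using hvv m (-z)

theorem esym_shuffle {R : Type*} [CommRing R] (v a b w : ℕ → R)
    (hv : ∀ i j, v i * v j = v (i + j + 1) * (v i + v j))
    (ha : ∀ i j, v i * a j = a (i + j + 1) * (v i + a j))
    (hb : ∀ i j, v i * b j = b (i + j + 1) * (v i + b j))
    (hw : ∀ i j, a i * b j = w (i + j + 1) * (a i + b j)) (N m : ℕ) :
    w m * (esym b (N + 1) m + (-1) ^ N * esym a (N + 1) m) =
      ∑ j ∈ antidiagonal N, (-1) ^ j.2 * ∑ q ∈ range m,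
        (a (m - 1 - q) * esym v j.1 (m - 1 - q)) * (b q * esym v j.2 q) := by
  have lift : ∀ {f g h : ℕ → R}, (∀ i j, f i * g j = h (i + j + 1) * (f i + g j)) →
      ∀ i j, C (f i) * C (g j) = C (h (i + j + 1)) * (C (f i) + C (g j)) := by
    intro f g h H i j
    rw [← map_mul, H, map_mul, map_add]
  have e1 := prod_one_add_partial_fraction (fun i => C (v i)) (fun i => C (b i)) (lift hv)
    (lift hb) (X : R⟦X⟧) m
  have e2 := prod_one_add_partial_fraction (fun i => C (v i)) (fun i => C (a i)) (lift hv)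
    (lift ha) (-X : R⟦X⟧) m
  rw [← sum_range_reflect] at e2
  simp only [neg_neg] at e2
  have main : X * ∑ q ∈ range m, (∏ i ∈ range (m - 1 - q), (1 + X * C (v i))) *
      (∏ i ∈ range q, (1 + -X * C (v i))) * (C (a (m - 1 - q)) * C (b q)) =
      C (w m) * (∏ i ∈ range m, (1 + X * C (b i)) - ∏ i ∈ range m, (1 + -X * C (a i))) := by
    rw [e1, e2]
    simp only [mul_sum, mul_sub, add_sub_add_left_eq_sub, ← sum_sub_distrib]
    refine sum_congr rfl fun q hq => ?_
    have hq := mem_range.1 hq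
    have := lift hw (m - 1 - q) q
    rw [show m - 1 - q + q + 1 = m by omega] at this
    rw [this, show m - 1 - (m - 1 - q) = q by omega]
    ring
  have := congrArg (coeff (N + 1)) main
  rw [coeff_succ_X_mul, coeff_C_mul, map_sub, coeff_prod_one_add, coeff_prod_one_sub] at this
  rw [pow_succ] at this
  rw [show w m * (esym b (N + 1) m + (-1) ^ N * esym a (N + 1) m) =
    w m * (esym b (N + 1) m - (-1) ^ N * (-1) * esym a (N + 1) m) by ring, ← this, map_sum]
  simp only [← map_mul, coeff_mul_C]
  simp only [coeff_mul, coeff_prod_one_add, coeff_prod_one_sub, mul_sum, sum_mul]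
  rw [sum_comm]
  refine sum_congr rfl fun j _ => sum_congr rfl fun q _ => ?_
  ring

/-- The power series `f(y X)` with complex coefficients. -/
noncomputable def complexRescale (y : ℂ) : ℝ≥0⟦X⟧ →+* ℂ⟦X⟧ :=
  (rescale y).comp (PowerSeries.map (Complex.ofRealHom.comp NNReal.toRealHom))

theorem coeff_complexRescale (y : ℂ) (f : ℝ≥0⟦X⟧) (n : ℕ) :
    coeff n (complexRescale y f) = y ^ n * (((coeff n f : ℝ≥0) : ℝ) : ℂ) := by
  simp [complexRescale, coeff_rescale]

/-- The geometric series expansion of `1 / (m + 1 - y X)`. -/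
noncomputable def geoC (y : ℂ) (m : ℕ) : ℂ⟦X⟧ := complexRescale y (geo m)

theorem coeff_geoC (y : ℂ) (m n : ℕ) :
    coeff n (geoC y m) = y ^ n * ((m : ℂ) + 1)⁻¹ ^ (n + 1) := by
  rw [geoC, coeff_complexRescale, geo, coeff_mk]
  simp [invSucc]

theorem sub_mul_geoC (y : ℂ) (m : ℕ) : (C ((m : ℂ) + 1) - C y * X) * geoC y m = 1 := by
  have hm : (m : ℂ) + 1 ≠ 0 := Nat.cast_add_one_ne_zero m
  ext n
  rw [sub_mul, map_sub, coeff_C_mul, mul_assoc, coeff_C_mul, coeff_one]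
  cases n with
  | zero => simp [coeff_geoC, hm]
  | succ n =>
    rw [coeff_succ_X_mul, coeff_geoC, coeff_geoC, if_neg n.succ_ne_zero]
    linear_combination y ^ (n + 1) * ((m : ℂ) + 1)⁻¹ ^ (n + 1) * mul_inv_cancel₀ hm

theorem geoC_mul_geoC (x y : ℂ) (i j : ℕ) :
    geoC x i * geoC y j = geoC (x + y) (i + j + 1) * (geoC x i + geoC y j) := by
  have h1 := sub_mul_geoC x i
  have h2 := sub_mul_geoC y j
  have h3 := sub_mul_geoC (x + y) (i + j + 1)
  have h4 : (C (((i + j + 1 : ℕ) : ℂ) + 1) - C (x + y) * X : ℂ⟦X⟧) =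
      (C ((i : ℂ) + 1) - C x * X) + (C ((j : ℂ) + 1) - C y * X) := by
    simp only [Nat.cast_add, Nat.cast_one, map_add]
    ring
  rw [h4] at h3
  linear_combination (-geoC x i * geoC y j) * h3 + geoC (x + y) (i + j + 1) * geoC y j * h1 +
    geoC (x + y) (i + j + 1) * geoC x i * h2

theorem esym_geoC_shuffle (x y : ℂ) (N m : ℕ) :
    geoC (x + y) m * (esym (geoC y) (N + 1) m + (-1) ^ N * esym (geoC x) (N + 1) m) =
      ∑ j ∈ antidiagonal N, (-1) ^ j.2 * ∑ q ∈ range m,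
        (geoC x (m - 1 - q) * esym (geoC 0) j.1 (m - 1 - q)) * (geoC y q * esym (geoC 0) j.2 q) :=
  esym_shuffle (geoC 0) (geoC x) (geoC y) (geoC (x + y))
    (fun i j => by simpa using geoC_mul_geoC 0 0 i j)
    (fun i j => by simpa using geoC_mul_geoC 0 x i j)
    (fun i j => by simpa using geoC_mul_geoC 0 y i j) (geoC_mul_geoC x y) N m

/-- The `m`-th summand of the generating series of the sums `G`. -/
noncomputable def summand (k : ℕ) (x y : ℂ) (m : ℕ) : ℂ⟦X⟧ :=
  (geoC x m - geoC 0 m) * esym (geoC y) k m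

theorem summand_shuffle (x y : ℂ) (N m : ℕ) :
    ∑ j ∈ antidiagonal N, (-1) ^ j.2 * ∑ q ∈ range m,
        summand j.1 x 0 (m - 1 - q) * summand j.2 y 0 q =
      summand (N + 1) (x + y) y m + (-1) ^ N * summand (N + 1) (x + y) x m
        - summand (N + 1) y y m - (-1) ^ N * summand (N + 1) y 0 m
        - summand (N + 1) x 0 m - (-1) ^ N * summand (N + 1) x x m := by
  have h1 := esym_geoC_shuffle x y N m
  have h2 := esym_geoC_shuffle 0 y N m
  have h3 := esym_geoC_shuffle x 0 N m
  have h4 := esym_geoC_shuffle 0 0 N m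
  simp only [zero_add, add_zero] at h2 h3 h4
  trans geoC (x + y) m * (esym (geoC y) (N + 1) m + (-1) ^ N * esym (geoC x) (N + 1) m)
    - geoC y m * (esym (geoC y) (N + 1) m + (-1) ^ N * esym (geoC 0) (N + 1) m)
    - geoC x m * (esym (geoC 0) (N + 1) m + (-1) ^ N * esym (geoC x) (N + 1) m)
    + geoC 0 m * (esym (geoC 0) (N + 1) m + (-1) ^ N * esym (geoC 0) (N + 1) m)
  · rw [h1, h2, h3, h4, ← sum_sub_distrib, ← sum_sub_distrib, ← sum_add_distrib]
    refine sum_congr rfl fun j _ => ?_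
    rw [← mul_sub, ← mul_sub, ← mul_add, ← sum_sub_distrib, ← sum_sub_distrib, ← sum_add_distrib]
    congr 1
    refine sum_congr rfl fun q _ => ?_
    simp only [summand]
    ring
  · simp only [summand]
    ring

/-- The coefficient of `X ^ d` in the generating series of the sums `G` of depth `k + 1`. -/
noncomputable def gCoeff (k : ℕ) (x y : ℂ) : ℕ → ℂ
  | 0 => 0
  | d + 1 => ∑ p ∈ antidiagonal d,
      x ^ (p.1 + 1) * y ^ p.2 * ((depthSum k (p.1 + 1) p.2).toReal : ℂ)

theorem hasSum_depthSum (k i : ℕ) {j : ℕ} (hj : 1 ≤ j) :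
    HasSum (fun m => (((invSucc m ^ (j + 1) * coeff i (esym geo k m) : ℝ≥0) : ℝ) : ℂ))
      ((depthSum k j i).toReal : ℂ) := by
  have h := ENNReal.hasSum_toReal (depthSum_ne_top k i hj)
  rw [← ENNReal.tsum_toReal_eq fun m => ENNReal.coe_ne_top] at h
  exact Complex.hasSum_ofReal.2 h

theorem hasSum_coeff_summand (k : ℕ) (x y : ℂ) (d : ℕ) :
    HasSum (fun m => coeff d (summand k x y m)) (gCoeff k x y d) := by
  cases d with
  | zero =>
    have h : ∀ m, coeff 0 (summand k x y m) = 0 := by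
      intro m
      rw [summand, coeff_mul, Nat.antidiagonal_zero, sum_singleton, map_sub, coeff_geoC, coeff_geoC]
      simp
    simp only [h, gCoeff, hasSum_zero]
  | succ d =>
    have h : ∀ m, coeff (d + 1) (summand k x y m) = ∑ p ∈ antidiagonal d, x ^ (p.1 + 1) *
        y ^ p.2 * (((invSucc m ^ (p.1 + 1 + 1) * coeff p.2 (esym geo k m) : ℝ≥0) : ℝ) : ℂ) := by
      intro m
      have hy : esym (geoC y) k m = complexRescale y (esym geo k m) :=
        (map_esym (complexRescale y) geo k m).symm
      rw [summand, coeff_mul, Nat.sum_antidiagonal_succ, hy]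
      simp only [map_sub, coeff_geoC, coeff_complexRescale]
      rw [show (x ^ 0 * ((m : ℂ) + 1)⁻¹ ^ (0 + 1) - 0 ^ 0 * ((m : ℂ) + 1)⁻¹ ^ (0 + 1)) = 0 by simp,
        zero_mul, zero_add]
      refine sum_congr rfl fun p _ => ?_
      rw [zero_pow p.1.succ_ne_zero]
      simp only [invSucc, NNReal.coe_mul, NNReal.coe_pow, NNReal.coe_inv, NNReal.coe_add,
        NNReal.coe_natCast, NNReal.coe_one, Complex.ofReal_mul, Complex.ofReal_pow,
        Complex.ofReal_inv, Complex.ofReal_add, Complex.ofReal_natCast, Complex.ofReal_one]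
      ring
    simp only [h]
    exact hasSum_sum fun p _ => (hasSum_depthSum k p.2 (Nat.le_add_left 1 p.1)).mul_left _

theorem hasSum_coeff_summand_mul (i j : ℕ) (x y : ℂ) (d : ℕ) :
    HasSum (fun m => coeff d (∑ q ∈ range m, summand i x 0 (m - 1 - q) * summand j y 0 q))
      (∑ p ∈ antidiagonal d, gCoeff i x 0 p.1 * gCoeff j y 0 p.2) := by
  simp only [map_sum, coeff_mul]
  simp only [sum_comm (s := range _)]
  refine hasSum_sum fun p _ => ?_
  rw [← hasSum_nat_add_iff' 1]
  have hf := hasSum_coeff_summand i x 0 p.1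
  have hg := hasSum_coeff_summand j y 0 p.2
  have := hasSum_sum_range_mul_of_summable_norm hg.summable.norm hf.summable.norm
  rw [hf.tsum_eq, hg.tsum_eq] at this
  simpa [mul_comm] using this

theorem gCoeff_zero_depth (x y : ℂ) (d : ℕ) : gCoeff 0 x y d = gCoeff 0 x x d :=
  (hasSum_coeff_summand 0 x y d).unique (by
    simpa [summand, esym] using hasSum_coeff_summand 0 x x d)

theorem gCoeff_shuffle (x y : ℂ) (N d : ℕ) :
    ∑ j ∈ antidiagonal N, (-1) ^ j.2 *
        ∑ p ∈ antidiagonal d, gCoeff j.1 x 0 p.1 * gCoeff j.2 y 0 p.2 =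
      gCoeff (N + 1) (x + y) y d + (-1) ^ N * gCoeff (N + 1) (x + y) x d
        - gCoeff (N + 1) y y d - (-1) ^ N * gCoeff (N + 1) y 0 d
        - gCoeff (N + 1) x 0 d - (-1) ^ N * gCoeff (N + 1) x x d := by
  have hc : ∀ (r : ℕ) (f : ℂ⟦X⟧), coeff d ((-1) ^ r * f) = (-1) ^ r * coeff d f := by
    intro r f
    rw [← coeff_C_mul]
    simp
  have h1 := hasSum_sum fun j (_ : j ∈ antidiagonal N) =>
    (hasSum_coeff_summand_mul j.1 j.2 x y d).mul_left ((-1) ^ j.2)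
  simp only [← hc, ← map_sum, summand_shuffle, map_sub, map_add] at h1
  simp only [hc] at h1
  have H := fun u v : ℂ => hasSum_coeff_summand (N + 1) u v d
  exact h1.unique ((((((H _ _).add ((H _ _).mul_left _)).sub (H _ _)).sub
    ((H _ _).mul_left _)).sub (H _ _)).sub ((H _ _).mul_left _))

theorem gCoeff_zero_right (k : ℕ) (x : ℂ) (d : ℕ) :
    gCoeff k x 0 (d + 1) = x ^ (d + 1) * ((depthSum k (d + 1) 0).toReal : ℂ) := by
  rw [gCoeff, sum_eq_single (d, 0)]
  · simp
  · rintro ⟨a, b⟩ h hne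
    rcases b with _ | b
    · simp only [HasAntidiagonal.mem_antidiagonal, add_zero] at h
      exact absurd (by rw [h]) hne
    · simp
  · simp

theorem gCoeff_self (k : ℕ) (x : ℂ) (d : ℕ) :
    gCoeff k x x (d + 1) = x ^ (d + 1) * (rz (d + k + 2) : ℂ) := by
  rw [rz_eq_toReal, ← sum_depthSum,
    ENNReal.toReal_sum fun p _ => depthSum_ne_top k p.2 (Nat.le_add_left 1 p.1), gCoeff]
  push_cast
  rw [mul_sum]
  refine sum_congr rfl fun p hp => ?_
  rw [← HasAntidiagonal.mem_antidiagonal.1 hp]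
  ring

theorem sum_antidiagonal_eq_sum_Icc {M : Type*} [AddCommMonoid M] (f : ℕ → ℕ → M) (N : ℕ) :
    ∑ j ∈ antidiagonal N, f j.1 j.2 = ∑ j ∈ Icc 1 (N + 1), f (j - 1) (N + 1 - j) := by
  rw [Nat.sum_antidiagonal_eq_sum_range_succ f, ← Ico_succ_right_eq_Icc, sum_Ico_eq_sum_range]
  refine sum_congr (by simp) fun j _ => ?_
  congr 1 <;> omega

theorem sum_antidiagonal_eq_sum_Icc_of_ends {M : Type*} [AddCommMonoid M] (f : ℕ → ℕ → M) (N : ℕ)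
    (h₀ : f 0 (N + 1) = 0) (h₁ : f (N + 1) 0 = 0) :
    ∑ j ∈ antidiagonal (N + 1), f j.1 j.2 = ∑ j ∈ Icc 1 N, f j (N + 1 - j) := by
  rw [Nat.sum_antidiagonal_eq_sum_range_succ f, sum_range_succ, sum_range_succ',
    ← Ico_succ_right_eq_Icc, sum_Ico_eq_sum_range]
  simp only [tsub_zero, tsub_self, h₀, h₁, add_zero]
  refine sum_congr (by simp) fun j _ => ?_
  rw [add_comm]

theorem gCoeff_zero_right_eq_mzv (k : ℕ) (x : ℂ) {d : ℕ} (hd : 1 ≤ d) :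
    gCoeff k x 0 d = x ^ d * (mzv (Fin.cons (d + 1) (fun _ : Fin k => 1)) : ℂ) := by
  obtain ⟨d, rfl⟩ := Nat.exists_eq_add_of_le' hd
  rw [gCoeff_zero_right, mzv_cons_ones]

theorem height_one_identity (k D : ℕ) (x y : ℂ) :
    gCoeff k (x + y) y (D + 1) + (-1) ^ (k + 1) * gCoeff k (x + y) x (D + 1)
        - ((-1) ^ (k + 1) * gCoeff k x x (D + 1) + gCoeff k y y (D + 1))
      = (∑ j ∈ Icc 1 k, ∑ i ∈ Icc 1 D,
          (-1) ^ (k - j) * gCoeff (j - 1) x 0 i * gCoeff (k - j) y 0 (D + 1 - i))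
        + (gCoeff k x 0 (D + 1) + (-1) ^ (k + 1) * gCoeff k y 0 (D + 1)) := by
  cases k with
  | zero =>
    simp only [gCoeff_zero_depth _ 0, gCoeff_zero_depth (x + y)]
    simp only [Icc_eq_empty_of_lt zero_lt_one, sum_empty]
    ring
  | succ N =>
    have h := gCoeff_shuffle x y N (D + 1)
    rw [sum_antidiagonal_eq_sum_Icc fun a b => (-1) ^ b *
      ∑ p ∈ antidiagonal (D + 1), gCoeff a x 0 p.1 * gCoeff b y 0 p.2] at h
    have hD : ∀ a b, ∑ p ∈ antidiagonal (D + 1), gCoeff a x 0 p.1 * gCoeff b y 0 p.2 =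
        ∑ i ∈ Icc 1 D, gCoeff a x 0 i * gCoeff b y 0 (D + 1 - i) := fun a b =>
      sum_antidiagonal_eq_sum_Icc_of_ends (fun i j => gCoeff a x 0 i * gCoeff b y 0 j) D
        (by simp [gCoeff]) (by simp [gCoeff])
    simp only [hD, mul_sum, ← mul_assoc] at h
    rw [h]
    ring
end HeightOne

theorem weighted_sum_height_one (l n : ℕ) (hn : 1 ≤ n) (hln : n < l) (x y : ℂ) :
    G l n (x + y) y + (-1 : ℂ) ^ n * G l n (y + x) x
        - ((-1 : ℂ) ^ n * x ^ (l - n) + y ^ (l - n)) * (rz l : ℂ)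
      = (∑ j₁ ∈ Finset.Icc 1 (n - 1), ∑ k₁ ∈ Finset.Icc 1 (l - n - 1),
          (-1 : ℂ) ^ (n - j₁ - 1) * x ^ k₁ * y ^ (l - n - k₁)
            * (mzv (Fin.cons (k₁ + 1) (fun _ : Fin (j₁ - 1) => 1)) : ℂ)
            * (mzv (Fin.cons (l - n - k₁ + 1) (fun _ : Fin (n - j₁ - 1) => 1)) : ℂ))
        + (x ^ (l - n) + (-1 : ℂ) ^ n * y ^ (l - n))
            * (mzv (Fin.cons (l - n + 1) (fun _ : Fin (n - 1) => 1)) : ℂ) := by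
  obtain ⟨k, rfl⟩ := Nat.exists_eq_add_of_le' hn
  obtain ⟨D, rfl⟩ := Nat.exists_eq_add_of_lt hln
  have hG : ∀ u v : ℂ, G (k + 1 + D + 1) (k + 1) u v = gCoeff k u v (D + 1) :=
    G_eq_sum_depthSum k D
  have hl : k + 1 + D + 1 - (k + 1) = D + 1 := by omega
  have hrz : D + k + 2 = k + 1 + D + 1 := by omega
  have h := height_one_identity k D x y
  rw [gCoeff_self, gCoeff_self, hrz, gCoeff_zero_right_eq_mzv k x D.succ_pos,
    gCoeff_zero_right_eq_mzv k y D.succ_pos] at h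
  simp only [hG, hl, add_comm y x, Nat.add_sub_cancel]
  rw [add_mul, mul_assoc, h, add_mul, mul_assoc ((-1) ^ (k + 1))]
  congr 1
  refine Finset.sum_congr rfl fun j _ => Finset.sum_congr rfl fun i hi => ?_
  have hi := Finset.mem_Icc.1 hi
  rw [show k + 1 - j - 1 = k - j by omega, gCoeff_zero_right_eq_mzv _ x hi.1,
    gCoeff_zero_right_eq_mzv _ y (show 1 ≤ D + 1 - i by omega)]
  ring
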